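/- arXiv:2502.11979 — 7 statements merged into one kernel-verified Lean document; each statement's English description precedes it below -/
import Mathlib

section
/- Let G = (V, E) be a finite undirected graph and B a nonempty finite multiset of drivers such that every driver (u, v, b) ∈ B has u ≠ v and u, v in the same connected component of G. Let b_max = max_{(u,v,b)∈B} b and let P = { b_max / 2^t : t ∈ {0, 1, …, ⌈log₂(4·|E|·|B|)⌉} } ∪ {0}. Then there exists a pricing p with p(e) ∈ P for every edge e ∈ E such that Rev(p) ≥ OPT / 4. -/
open scoped ENNReal

namespace Toll

/-- The total price (weight) of a walk: sum of prices of its edges. -/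
noncomputable def walkWeight {V : Type*} (G : SimpleGraph V) (p : Sym2 V → NNReal)
    {u v : V} (wk : G.Walk u v) : NNReal :=
  (wk.edges.map p).sum

/-- The distance between `u` and `v` under pricing `p`: the minimum total price of
a `u`–`v` path (`∞` if there is none). -/
noncomputable def gdist {V : Type*} (G : SimpleGraph V) (p : Sym2 V → NNReal)
    (u v : V) : ℝ≥0∞ :=
  ⨅ wk : G.Walk u v, (walkWeight G p wk : ℝ≥0∞)

/-- The revenue of pricing `p` with respect to the driver multiset `B`. -/
noncomputable def rev {V : Type*} (G : SimpleGraph V) (B : Multiset (V × V × NNReal))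
    (p : Sym2 V → NNReal) : ℝ≥0∞ :=
  (B.map fun d =>
    if gdist G p d.1 d.2.1 ≤ (d.2.2 : ℝ≥0∞) then gdist G p d.1 d.2.1 else 0).sum

/-- The optimal revenue: supremum of the revenue over all pricings. -/
noncomputable def OPT {V : Type*} (G : SimpleGraph V) (B : Multiset (V × V × NNReal)) : ℝ≥0∞ :=
  ⨆ p : Sym2 V → NNReal, rev G B p

/-- The maximum budget of a driver in `B`. -/
noncomputable def bmax {V : Type*} (B : Multiset (V × V × NNReal)) : NNReal :=
  (B.map fun d => d.2.2).sup

end Toll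

open Toll

namespace Toll

/-- The admissible prices: `c / 2 ^ t` for `t ≤ T`, together with `0`. -/
def gridPrices (c : NNReal) (T : ℕ) : Set NNReal :=
  {x : NNReal | ∃ t : ℕ, t ≤ T ∧ x = c / 2 ^ t} ∪ {0}

theorem gridPrices_finite (c : NNReal) (T : ℕ) : (gridPrices c T).Finite := by
  refine Set.Finite.union (((Set.finite_Iic T).image fun t => c / 2 ^ t).subset ?_)
    (Set.finite_singleton 0)
  rintro x ⟨t, ht, rfl⟩
  exact ⟨t, ht, rfl⟩

theorem exists_pow_round_down (c x : NNReal) (T : ℕ) (h : c / 2 ^ T ≤ x) :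
    ∃ t ≤ T, c / 2 ^ t ≤ x ∧ min x c ≤ 2 * (c / 2 ^ t) := by
  induction T with
  | zero =>
    refine ⟨0, le_rfl, h, (min_le_right _ _).trans ?_⟩
    rw [pow_zero, div_one, two_mul]
    exact le_self_add
  | succ T ih =>
    by_cases hT : c / 2 ^ T ≤ x
    · obtain ⟨t, ht, h₁, h₂⟩ := ih hT
      exact ⟨t, ht.trans T.le_succ, h₁, h₂⟩
    · refine ⟨T + 1, le_rfl, h, (min_le_left _ _).trans ((not_le.mp hT).le.trans_eq ?_)⟩
      rw [pow_succ]
      field_simp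

/-- Every price can be rounded down to an admissible one, losing at most a factor `2` and an
additive `c / 2 ^ T` once the price is capped at `c`. -/
theorem exists_gridPrices_round_down (c : NNReal) (T : ℕ) (x : NNReal) :
    ∃ y ∈ gridPrices c T, y ≤ x ∧ min x c ≤ 2 * y + c / 2 ^ T := by
  by_cases h : c / 2 ^ T ≤ x
  · obtain ⟨t, ht, h₁, h₂⟩ := exists_pow_round_down c x T h
    exact ⟨_, Or.inl ⟨t, ht, rfl⟩, h₁, h₂.trans le_self_add⟩
  · refine ⟨0, Or.inr rfl, zero_le, (min_le_left _ _).trans ?_⟩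
    simpa using (not_le.mp h).le

theorem min_sum_le_of_forall_min_le {α : Type*} (l : List α) (p q : α → NNReal) (c δ : NNReal)
    (h : ∀ e, min (p e) c ≤ 2 * q e + δ) :
    min (l.map p).sum c ≤ 2 * (l.map q).sum + l.length * δ := by
  induction l with
  | nil => simp
  | cons a l ih =>
    have hmin : min (p a + (l.map p).sum) c ≤ min (p a) c + min (l.map p).sum c := by
      rcases le_total (p a) c with h₁ | h₁
      · rcases le_total (l.map p).sum c with h₂ | h₂
        · rw [min_eq_left h₁, min_eq_left h₂]
          exact min_le_left _ _
        · rw [min_eq_right h₂]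
          exact (min_le_right _ _).trans le_add_self
      · rw [min_eq_right h₁]
        exact (min_le_right _ _).trans le_self_add
    simp only [List.map_cons, List.sum_cons, List.length_cons]
    refine hmin.trans ((add_le_add (h a) ih).trans_eq ?_)
    push_cast
    ring

section

variable {V : Type*} (G : SimpleGraph V)

theorem gdist_le_walkWeight (p : Sym2 V → NNReal) {u v : V} (w : G.Walk u v) :
    gdist G p u v ≤ (walkWeight G p w : ℝ≥0∞) :=
  iInf_le _ w

theorem walkWeight_mono {p q : Sym2 V → NNReal} (h : ∀ e, q e ≤ p e) {u v : V}
    (w : G.Walk u v) : walkWeight G q w ≤ walkWeight G p w :=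
  List.sum_le_sum fun e _ => h e

theorem gdist_mono {p q : Sym2 V → NNReal} (h : ∀ e, q e ≤ p e) (u v : V) :
    gdist G q u v ≤ gdist G p u v :=
  iInf_mono fun w => ENNReal.coe_le_coe.mpr (walkWeight_mono G h w)

theorem walkWeight_bypass_le [DecidableEq V] (p : Sym2 V → NNReal) {u v : V} (w : G.Walk u v) :
    walkWeight G p w.bypass ≤ walkWeight G p w := by
  have hsub : w.bypass.edges.Subperm w.edges :=
    w.bypass_isPath.isTrail.edges_nodup.subperm w.edges_bypass_subset_edges
  obtain ⟨l, hl, hs⟩ := hsub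
  unfold walkWeight
  rw [← (hl.map p).sum_eq]
  exact (hs.map p).sum_le_sum (by simp)

/-- If `q` rounds `p` down as in `exists_gridPrices_round_down`, distances not exceeding the cap
shrink at most by a factor `2` and an additive `|E| δ`. -/
theorem gdist_le_two_mul_gdist_add [Fintype V] [DecidableEq V] [DecidableRel G.Adj]
    {p q : Sym2 V → NNReal} {c δ : NNReal} (h : ∀ e, min (p e) c ≤ 2 * q e + δ) {u v : V}
    (huv : gdist G p u v ≤ c) :
    gdist G p u v ≤ 2 * gdist G q u v + ((G.edgeFinset.card * δ : NNReal) : ℝ≥0∞) := by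
  conv_rhs => rw [gdist, ENNReal.mul_iInf_of_ne (by simp) (by simp), ENNReal.iInf_add]
  refine le_iInf fun w => ?_
  have hb := min_sum_le_of_forall_min_le w.bypass.edges p q c δ h
  have hlen : (w.bypass.edges.length : NNReal) ≤ G.edgeFinset.card := by
    rw [SimpleGraph.Walk.length_edges]
    exact_mod_cast w.bypass_isPath.isTrail.length_le_card_edgeFinset
  have hw : min (walkWeight G p w.bypass) c ≤ 2 * walkWeight G q w + G.edgeFinset.card * δ := by
    refine hb.trans (add_le_add ?_ ?_)
    · exact mul_le_mul_of_nonneg_left (walkWeight_bypass_le G q w) zero_le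
    · exact mul_le_mul_of_nonneg_right hlen zero_le
  refine (le_min (gdist_le_walkWeight G p w.bypass) huv).trans ?_
  exact_mod_cast hw

theorem rev_le_two_mul_rev_add [Fintype V] [DecidableEq V] [DecidableRel G.Adj]
    (B : Multiset (V × V × NNReal)) {p q : Sym2 V → NNReal} {c δ : NNReal}
    (hqp : ∀ e, q e ≤ p e) (h : ∀ e, min (p e) c ≤ 2 * q e + δ) (hc : ∀ d ∈ B, d.2.2 ≤ c) :
    rev G B p ≤
      2 * rev G B q + Multiset.card B * ((G.edgeFinset.card * δ : NNReal) : ℝ≥0∞) := by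
  unfold rev
  rw [← nsmul_eq_mul, ← Multiset.sum_replicate, ← Multiset.map_const', ← Multiset.sum_map_mul_left,
    ← Multiset.sum_map_add]
  refine Multiset.sum_map_le_sum_map _ _ fun d hd => ?_
  by_cases hdp : gdist G p d.1 d.2.1 ≤ (d.2.2 : ℝ≥0∞)
  · rw [if_pos hdp, if_pos ((gdist_mono G hqp _ _).trans hdp)]
    exact gdist_le_two_mul_gdist_add G h (hdp.trans (ENNReal.coe_le_coe.mpr (hc d hd)))
  · rw [if_neg hdp]
    exact zero_le

/-- The pricing charging `c` on the edges incident to `u` and nothing elsewhere. -/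
noncomputable def starPricing [DecidableEq V] (c : NNReal) (u : V) (e : Sym2 V) : NNReal :=
  if u ∈ e then c else 0

theorem gdist_starPricing [DecidableEq V] (c : NNReal) {u v : V} (huv : u ≠ v)
    (hr : G.Reachable u v) : gdist G (starPricing c u) u v = c := by
  apply le_antisymm
  · obtain ⟨w, hw⟩ := hr.exists_isPath
    refine (gdist_le_walkWeight G _ w).trans (ENNReal.coe_le_coe.mpr ?_)
    cases w with
    | nil => exact absurd rfl huv
    | cons h w =>
      rw [SimpleGraph.Walk.cons_isPath_iff] at hw
      have hz : (w.edges.map (starPricing c u)).sum = 0 := by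
        refine List.sum_eq_zero fun x hx => ?_
        obtain ⟨e, he, rfl⟩ := List.mem_map.mp hx
        exact if_neg fun hu => hw.2 (w.mem_support_of_mem_edges he hu)
      simp [walkWeight, hz, starPricing]
  · refine le_iInf fun w => ENNReal.coe_le_coe.mpr ?_
    cases w with
    | nil => exact absurd rfl huv
    | cons h w => simp [walkWeight, starPricing]

theorem le_rev_starPricing [DecidableEq V] {B : Multiset (V × V × NNReal)}
    {d : V × V × NNReal} (hd : d ∈ B) (hne : d.1 ≠ d.2.1) (hr : G.Reachable d.1 d.2.1)
    {c : NNReal} (hc : c ≤ d.2.2) : (c : ℝ≥0∞) ≤ rev G B (starPricing c d.1) := by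
  have hg := gdist_starPricing G c hne hr
  refine le_trans ?_ (Multiset.single_le_sum (fun _ _ => zero_le) _
    (Multiset.mem_map_of_mem _ hd))
  rw [hg, if_pos (ENNReal.coe_le_coe.mpr hc)]

end

theorem le_bmax {V : Type*} {B : Multiset (V × V × NNReal)} {d : V × V × NNReal} (hd : d ∈ B) :
    d.2.2 ≤ bmax B :=
  Multiset.le_sup (Multiset.mem_map_of_mem (fun d : V × V × NNReal => d.2.2) hd)

theorem exists_bmax_le {V : Type*} {B : Multiset (V × V × NNReal)} (hB : B ≠ 0) :
    ∃ d ∈ B, bmax B ≤ d.2.2 := by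
  classical
  obtain ⟨d, hd, hmax⟩ := B.toFinset.exists_max_image (fun d => d.2.2)
    (Multiset.toFinset_nonempty.mpr hB)
  refine ⟨d, Multiset.mem_toFinset.mp hd, Multiset.sup_le.mpr fun x hx => ?_⟩
  obtain ⟨e, he, rfl⟩ := Multiset.mem_map.mp hx
  exact hmax e (Multiset.mem_toFinset.mpr he)

theorem mul_mul_div_two_pow_clog_le (m n : ℕ) (c : NNReal) :
    (n : NNReal) * (m * (c / 2 ^ Nat.clog 2 (4 * m * n))) ≤ c := by
  have hnat : m * n ≤ 2 ^ Nat.clog 2 (4 * m * n) :=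
    le_trans (by nlinarith [Nat.zero_le (m * n)]) (Nat.le_pow_clog one_lt_two _)
  have hcast : (m * n : NNReal) ≤ 2 ^ Nat.clog 2 (4 * m * n) := by exact_mod_cast hnat
  calc (n : NNReal) * (m * (c / 2 ^ Nat.clog 2 (4 * m * n)))
      = (m * n) * c / 2 ^ Nat.clog 2 (4 * m * n) := by ring
    _ ≤ c := div_le_of_le_mul₀ zero_le zero_le (by
        rw [mul_comm c]
        exact mul_le_mul_of_nonneg_right hcast zero_le)

end Toll

/-- **Rounding Lemma.** There is a pricing taking values only in
`{bmax/2^t : 0 ≤ t ≤ ⌈log₂(4|E||B|)⌉} ∪ {0}` on the edges whose revenue is at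
least a quarter of the optimum. -/
theorem rounding_lemma {V : Type*} [Fintype V] [DecidableEq V]
    (G : SimpleGraph V) [DecidableRel G.Adj]
    (B : Multiset (V × V × NNReal)) (hB : B ≠ 0)
    (hdrivers : ∀ d ∈ B, d.1 ≠ d.2.1 ∧ G.Reachable d.1 d.2.1) :
    ∃ p : Sym2 V → NNReal,
      (∀ e ∈ G.edgeSet, p e ∈
        ({x : NNReal | ∃ t : ℕ,
            t ≤ Nat.clog 2 (4 * G.edgeFinset.card * Multiset.card B) ∧
            x = bmax B / 2 ^ t} ∪ {0} : Set NNReal)) ∧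
      OPT G B / 4 ≤ rev G B p := by
  set c := bmax B with hc
  set T := Nat.clog 2 (4 * G.edgeFinset.card * Multiset.card B) with hT
  obtain ⟨d, hd, hdc⟩ := exists_bmax_le hB
  have hstar : ∀ e, starPricing c d.1 e ∈ gridPrices c T := by
    intro e
    unfold starPricing
    split_ifs
    · exact Or.inl ⟨0, zero_le, by simp⟩
    · exact Or.inr rfl
  have hfin : {p : Sym2 V → NNReal | ∀ e, p e ∈ gridPrices c T}.Finite := by
    simpa [Set.pi] using Set.Finite.pi' fun _ : Sym2 V => gridPrices_finite c T
  obtain ⟨m, hm, hmax⟩ := hfin.exists_maximalFor (rev G B) _ ⟨_, hstar⟩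
  have hle : ∀ q : Sym2 V → NNReal, (∀ e, q e ∈ gridPrices c T) → rev G B q ≤ rev G B m :=
    fun q hq => (le_total _ _).elim id (hmax hq)
  refine ⟨m, fun e _ => hm e, ENNReal.div_le_of_le_mul (iSup_le fun p => ?_)⟩
  choose q hq hqp hmin using fun e => exists_gridPrices_round_down c T (p e)
  have hloss : (Multiset.card B : ℝ≥0∞) *
      ((G.edgeFinset.card * (c / 2 ^ T) : NNReal) : ℝ≥0∞) ≤ c := by
    exact_mod_cast mul_mul_div_two_pow_clog_le G.edgeFinset.card (Multiset.card B) c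
  have hcm : (c : ℝ≥0∞) ≤ rev G B m :=
    (le_rev_starPricing G hd (hdrivers d hd).1 (hdrivers d hd).2 hdc).trans (hle _ hstar)
  calc rev G B p
      ≤ 2 * rev G B q + Multiset.card B * ((G.edgeFinset.card * (c / 2 ^ T) : NNReal) : ℝ≥0∞) :=
        rev_le_two_mul_rev_add G B hqp hmin fun _ => le_bmax
    _ ≤ 2 * rev G B m + rev G B m :=
        add_le_add (mul_le_mul_right (hle q hq) 2) (hloss.trans hcm)
    _ ≤ 2 * rev G B m + (rev G B m + rev G B m) := add_le_add_right le_self_add _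
    _ = rev G B m * 4 := by ring
end

section
/- For every m ≥ 1, at every level of the middle-row decomposition of the integer interval [1, m], the lengths of any two blocks at that level differ by at most one. -/
/-- The children of a block `[a, b]` in the middle-row decomposition: with middle row
`c = ⌊(a + b)/2⌋`, the upper block `[a, c-1]` and the lower block `[c+1, b]`,
whenever these are nonempty. -/
def midChildren (blk : ℕ × ℕ) : Finset (ℕ × ℕ) :=
  (if blk.1 + 1 ≤ (blk.1 + blk.2) / 2 then {(blk.1, (blk.1 + blk.2) / 2 - 1)} else ∅) ∪
  (if (blk.1 + blk.2) / 2 + 1 ≤ blk.2 then {((blk.1 + blk.2) / 2 + 1, blk.2)} else ∅)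

/-- The levels of the middle-row decomposition of the interval `[1, m]`:
level `0` (i.e. level 1 in the paper, one-based) is the single block `[1, m]`,
and each subsequent level consists of all children of the blocks of the previous one. -/
def decompLevel (m : ℕ) : ℕ → Finset (ℕ × ℕ)
  | 0 => {(1, m)}
  | n + 1 => (decompLevel m n).biUnion midChildren

/-- If the lengths of two blocks differ by at most one, so do the lengths of their children. -/
theorem abs_length_sub_le_one_of_mem_midChildren {p q b₁ b₂ : ℕ × ℕ}
    (hpq : |((p.2 : ℤ) + 1 - p.1) - ((q.2 : ℤ) + 1 - q.1)| ≤ 1)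
    (h₁ : b₁ ∈ midChildren p) (h₂ : b₂ ∈ midChildren q) :
    |((b₁.2 : ℤ) + 1 - b₁.1) - ((b₂.2 : ℤ) + 1 - b₂.1)| ≤ 1 := by
  have mem_iff (b r : ℕ × ℕ) : b ∈ midChildren r ↔
      (r.1 + 1 ≤ (r.1 + r.2) / 2 ∧ b = (r.1, (r.1 + r.2) / 2 - 1)) ∨
      ((r.1 + r.2) / 2 + 1 ≤ r.2 ∧ b = ((r.1 + r.2) / 2 + 1, r.2)) := by
    unfold midChildren
    split_ifs <;> simp [*]
  rw [mem_iff] at h₁ h₂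
  rw [abs_le] at hpq ⊢
  rcases h₁ with ⟨h₁, rfl⟩ | ⟨h₁, rfl⟩ <;> rcases h₂ with ⟨h₂, rfl⟩ | ⟨h₂, rfl⟩ <;>
    dsimp only <;> omega

/-- At every level of the middle-row decomposition of `[1, m]`, the lengths
(`b - a + 1` for a block `[a, b]`) of any two blocks differ by at most one. -/
theorem decomp_block_lengths (m : ℕ) (hm : 1 ≤ m) (n : ℕ)
    (b₁ b₂ : ℕ × ℕ) (h₁ : b₁ ∈ decompLevel m n) (h₂ : b₂ ∈ decompLevel m n) :
    |((b₁.2 : ℤ) + 1 - b₁.1) - ((b₂.2 : ℤ) + 1 - b₂.1)| ≤ 1 := by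
  induction n generalizing b₁ b₂ with
  | zero =>
    simp only [decompLevel, Finset.mem_singleton] at h₁ h₂
    simp [h₁, h₂]
  | succ n ih =>
    simp only [decompLevel, Finset.mem_biUnion] at h₁ h₂
    obtain ⟨p, hp, h₁⟩ := h₁
    obtain ⟨q, hq, h₂⟩ := h₂
    exact abs_length_sub_le_one_of_mem_midChildren (ih p q hp hq) h₁ h₂
end

section
/- Let G be a finite undirected connected graph with a nonnegative real edge-weight function, and let S be a subset of its vertices. Then there exists a family (P_{a,b}), indexed by the unordered pairs {a, b} of distinct vertices of S, such that each P_{a,b} is a minimum-weight a–b path in G, and the number of vertices outside S that are crossing vertices of some pair of paths from the family is at most C(|S|, 2) · (C(|S|, 2) − 1), where C(n, 2) = n(n−1)/2. -/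
/-- `x` is a crossing vertex of the walks `P` and `Q`: it lies on both, and it is an
endpoint of a maximal common subpath, i.e. a vertex at which the two paths join or
diverge.  For simple paths this is equivalent to saying that the sets of edges of the
two paths incident to `x` differ (for `x` not an endpoint of either path). -/
def CrossingVertex {V : Type*} (G : SimpleGraph V) {a b c d : V}
    (P : G.Walk a b) (Q : G.Walk c d) (x : V) : Prop :=
  x ∈ P.support ∧ x ∈ Q.support ∧
    {e : Sym2 V | e ∈ P.edges ∧ x ∈ e} ≠ {e : Sym2 V | e ∈ Q.edges ∧ x ∈ e}

namespace SimpleGraph.Walk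

variable {V : Type*} {G : SimpleGraph V}

/-- Two paths with the same ends are equal as soon as the edges of one are among those of the
other. -/
theorem IsPath.eq_of_edges_subset {u v : V} {p q : G.Walk u v} (hp : p.IsPath) (hq : q.IsPath)
    (h : p.edges ⊆ q.edges) : p = q := by
  induction p with
  | nil => exact (isPath_iff_nil.1 hq).eq_nil.symm
  | @cons u u' v huu' p ih =>
    rw [cons_isPath_iff] at hp
    cases q with
    | nil => exact absurd p.end_mem_support hp.2
    | @cons _ v' _ huv' q =>
      rw [cons_isPath_iff] at hq
      have hv : u' = v' := by
        have h1 : s(u, u') ∈ (cons huv' q).edges := h (by simp)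
        rw [edges_cons, List.mem_cons] at h1
        rcases h1 with h1 | h1
        · exact Sym2.congr_right.1 h1
        · exact absurd (q.fst_mem_support_of_mem_edges h1) hq.2
      subst hv
      rw [ih hp.1 hq.1]
      intro e he
      have h1 : e ∈ (cons huv' q).edges := h (by simp [he])
      rw [edges_cons, List.mem_cons] at h1
      rcases h1 with rfl | h1
      · exact absurd (p.fst_mem_support_of_mem_edges he) hp.2
      · exact h1

/-- In a path, all edges at an inner vertex of a subpath belong to that subpath. -/
theorem IsPath.mem_edges_append_iff {a b x y z : V} {p : G.Walk a x} {q : G.Walk x z}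
    {r : G.Walk z b} (h : (p.append (q.append r)).IsPath) (hy : y ∈ q.support) (hyx : y ≠ x)
    (hyz : y ≠ z) {e : Sym2 V} (hye : y ∈ e) :
    e ∈ (p.append (q.append r)).edges ↔ e ∈ q.edges := by
  have hp : y ∉ p.support := fun hyp => by
    have hd := h.support_nodup
    rw [support_append] at hd
    refine (List.nodup_append.1 hd).2.2 y hyp y ?_ rfl
    have : y ∈ (q.append r).support := by simp [hy]
    exact ((mem_support_iff _).1 this).resolve_left hyx
  have hr : y ∉ r.support := fun hyr => by
    have hd := h.of_append_right.support_nodup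
    rw [support_append] at hd
    exact (List.nodup_append.1 hd).2.2 y hy y (((mem_support_iff _).1 hyr).resolve_left hyz) rfl
  obtain ⟨t, rfl⟩ := Sym2.mem_iff_exists.1 hye
  simp only [edges_append, List.mem_append]
  constructor
  · rintro (h1 | h1 | h1)
    · exact absurd (p.fst_mem_support_of_mem_edges h1) hp
    · exact h1
    · exact absurd (r.fst_mem_support_of_mem_edges h1) hr
  · exact fun h1 => Or.inr (Or.inl h1)

/-- The walk `p` visits `x`, `y` and `z` in this order. -/
def Visits {a b : V} (p : G.Walk a b) (x y z : V) : Prop :=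
  ∃ (q : G.Walk a x) (r : G.Walk x z) (s : G.Walk z b),
    p = q.append (r.append s) ∧ y ∈ r.support

theorem exists_eq_append_of_mem_support {a b x : V} {p : G.Walk a b} (h : x ∈ p.support) :
    ∃ (q : G.Walk a x) (r : G.Walk x b), p = q.append r := by
  classical
  exact ⟨p.takeUntil x h, p.dropUntil x h, (p.take_spec h).symm⟩

theorem visits_or {a b x y z : V} {p : G.Walk a b} (hx : x ∈ p.support) (hy : y ∈ p.support)
    (hz : z ∈ p.support) :
    p.Visits x y z ∨ p.Visits z y x ∨ p.Visits x z y ∨ p.Visits y z x ∨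
      p.Visits y x z ∨ p.Visits z x y := by
  obtain ⟨q, r, rfl⟩ := exists_eq_append_of_mem_support hy
  rw [mem_support_append_iff] at hx hz
  rcases hx with hx | hx <;> rcases hz with hz | hz
  · obtain ⟨q, q', rfl⟩ := exists_eq_append_of_mem_support hx
    rw [mem_support_append_iff] at hz
    rcases hz with hz | hz
    · obtain ⟨q, q'', rfl⟩ := exists_eq_append_of_mem_support hz
      refine Or.inr <| Or.inr <| Or.inr <| Or.inr <| Or.inr
        ⟨q, q''.append q', r, by simp [append_assoc], by simp⟩
    · exact Or.inr <| Or.inr <| Or.inl ⟨q, q', r, by simp [append_assoc], hz⟩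
  · obtain ⟨q, q', rfl⟩ := exists_eq_append_of_mem_support hx
    obtain ⟨r, r', rfl⟩ := exists_eq_append_of_mem_support hz
    exact Or.inl ⟨q, q'.append r, r', by simp [append_assoc], by simp⟩
  · obtain ⟨q, q', rfl⟩ := exists_eq_append_of_mem_support hz
    obtain ⟨r, r', rfl⟩ := exists_eq_append_of_mem_support hx
    exact Or.inr <| Or.inl ⟨q, q'.append r, r', by simp [append_assoc], by simp⟩
  · obtain ⟨r, r', rfl⟩ := exists_eq_append_of_mem_support hx
    rw [mem_support_append_iff] at hz
    rcases hz with hz | hz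
    · exact Or.inr <| Or.inr <| Or.inr <| Or.inl ⟨q, r, r', rfl, hz⟩
    · obtain ⟨r', r'', rfl⟩ := exists_eq_append_of_mem_support hz
      exact Or.inr <| Or.inr <| Or.inr <| Or.inr <| Or.inl
        ⟨q, r.append r', r'', by simp [append_assoc], by simp⟩

section Weight

variable {M : Type*} [AddCommMonoid M]

/-- The total weight of the edges of a walk. -/
def weight (ω : Sym2 V → M) {a b : V} (p : G.Walk a b) : M := (p.edges.map ω).sum

theorem weight_append (ω : Sym2 V → M) {a b c : V} (p : G.Walk a b) (q : G.Walk b c) :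
    (p.append q).weight ω = p.weight ω + q.weight ω := by
  simp [weight]

theorem weight_reverse (ω : Sym2 V → M) {a b : V} (p : G.Walk a b) :
    p.reverse.weight ω = p.weight ω := by
  simp [weight, List.sum_reverse]

variable [LinearOrder M]

/-- A path of minimum weight among all walks with the same ends. -/
def IsMinPath (ω : Sym2 V → M) {a b : V} (p : G.Walk a b) : Prop :=
  p.IsPath ∧ ∀ q : G.Walk a b, p.weight ω ≤ q.weight ω

variable {ω : Sym2 V → M}

theorem IsMinPath.reverse {a b : V} {p : G.Walk a b} (h : p.IsMinPath ω) :
    p.reverse.IsMinPath ω :=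
  ⟨h.1.reverse, fun q => by simpa only [weight_reverse] using h.2 q.reverse⟩

variable [IsOrderedCancelAddMonoid M]

theorem IsMinPath.of_append {a b x z : V} {p : G.Walk a x} {q : G.Walk x z} {r : G.Walk z b}
    (h : (p.append (q.append r)).IsMinPath ω) : q.IsMinPath ω := by
  refine ⟨h.1.of_append_right.of_append_left, fun q' => ?_⟩
  have := h.2 (p.append (q'.append r))
  simp only [weight_append] at this
  exact le_of_add_le_add_right (le_of_add_le_add_left this)

theorem exists_isMinPath [Fintype V] (hω : ∀ e, 0 ≤ ω e) (hG : G.Connected) (a b : V) :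
    ∃ p : G.Walk a b, p.IsMinPath ω := by
  classical
  obtain ⟨p₀⟩ := hG.preconnected a b
  have : Nonempty (G.Path a b) := ⟨p₀.toPath⟩
  obtain ⟨p, hp⟩ := Finite.exists_min fun p : G.Path a b => (p : G.Walk a b).weight ω
  refine ⟨p, p.2, fun q => (hp q.toPath).trans ?_⟩
  refine List.Sublist.sum_le_sum (q.edges_bypass_sublist_edges.map ω) ?_
  simp only [List.mem_map]
  rintro _ ⟨e, -, rfl⟩
  exact hω e

/-- If minimum-weight paths are unique, two such paths do not cross at a vertex that one of them
visits strictly between two vertices of the other. -/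
theorem Visits.not_crossingVertex
    (huniq : ∀ {a b : V} {p q : G.Walk a b}, p.IsMinPath ω → q.IsMinPath ω → p = q)
    {a b c d x y z : V} {p : G.Walk a b} {q : G.Walk c d} (hp : p.IsMinPath ω)
    (hq : q.IsMinPath ω) (h : p.Visits x y z) (hyx : y ≠ x) (hyz : y ≠ z)
    (hx : x ∈ q.support) (hz : z ∈ q.support) : ¬ CrossingVertex G p q y := by
  obtain ⟨p₁, r, p₂, rfl, hy⟩ := h
  rintro ⟨-, -, hne⟩
  refine hne (Set.ext fun e => and_congr_left fun hye => ?_)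
  rw [hp.1.mem_edges_append_iff hy hyx hyz hye]
  obtain ⟨q₁, q₂, rfl⟩ := exists_eq_append_of_mem_support hx
  rw [mem_support_append_iff] at hz
  rcases hz with hz | hz
  · obtain ⟨q₁, q', rfl⟩ := exists_eq_append_of_mem_support hz
    rw [← append_assoc] at hq ⊢
    obtain rfl := huniq hp.of_append.reverse hq.of_append
    rw [hq.1.mem_edges_append_iff (by simpa using hy) hyz hyx hye]
    simp
  · obtain ⟨q', q₂, rfl⟩ := exists_eq_append_of_mem_support hz
    obtain rfl := huniq hp.of_append hq.of_append
    rw [hq.1.mem_edges_append_iff hy hyx hyz hye]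

theorem not_three_crossingVertex
    (huniq : ∀ {a b : V} {p q : G.Walk a b}, p.IsMinPath ω → q.IsMinPath ω → p = q)
    {a b c d x y z : V} {p : G.Walk a b} {q : G.Walk c d} (hp : p.IsMinPath ω)
    (hq : q.IsMinPath ω) (hx : CrossingVertex G p q x) (hy : CrossingVertex G p q y)
    (hz : CrossingVertex G p q z) (hxy : x ≠ y) (hxz : x ≠ z) (hyz : y ≠ z) : False := by
  rcases visits_or hx.1 hy.1 hz.1 with h | h | h | h | h | h
  · exact h.not_crossingVertex huniq hp hq hxy.symm hyz hx.2.1 hz.2.1 hy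
  · exact h.not_crossingVertex huniq hp hq hyz hxy.symm hz.2.1 hx.2.1 hy
  · exact h.not_crossingVertex huniq hp hq hxz.symm hyz.symm hx.2.1 hy.2.1 hz
  · exact h.not_crossingVertex huniq hp hq hyz.symm hxz.symm hy.2.1 hx.2.1 hz
  · exact h.not_crossingVertex huniq hp hq hxy hxz hy.2.1 hz.2.1 hx
  · exact h.not_crossingVertex huniq hp hq hxz hxy hz.2.1 hy.2.1 hx

end Weight

/-- The weight `w`, with ties broken by powers of two attached to the edges. -/
noncomputable def lexWeight [Fintype V] [DecidableEq V] (w : Sym2 V → ℝ) (e : Sym2 V) : ℝ ×ₗ ℕ :=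
  toLex (w e, 2 ^ (Fintype.equivFin (Sym2 V) e : ℕ))

variable [Fintype V] [DecidableEq V] {w : Sym2 V → ℝ}

theorem weight_lexWeight {a b : V} (p : G.Walk a b) :
    p.weight (lexWeight w) = toLex (p.weight w,
      p.weight fun e => 2 ^ (Fintype.equivFin (Sym2 V) e : ℕ)) := by
  unfold weight
  induction p.edges with
  | nil => rfl
  | cons e l ih => simp only [List.map_cons, List.sum_cons, ih]; rfl

theorem IsMinPath.lexWeight_unique {a b : V} {p q : G.Walk a b}
    (hp : p.IsMinPath (lexWeight w)) (hq : q.IsMinPath (lexWeight w)) : p = q := by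
  have h := le_antisymm (hp.2 q) (hq.2 p)
  simp only [weight_lexWeight, EmbeddingLike.apply_eq_iff_eq, Prod.mk.injEq] at h
  have key : ∀ r : G.Walk a b, r.IsPath →
      (r.weight fun e => 2 ^ (Fintype.equivFin (Sym2 V) e : ℕ)) =
        ∑ i ∈ r.edges.toFinset.map ((Fintype.equivFin (Sym2 V)).toEmbedding.trans
          Fin.valEmbedding), 2 ^ i := fun r hr => by
    rw [Finset.sum_map, List.sum_toFinset _ hr.isTrail.edges_nodup]
    rfl
  rw [key p hp.1, key q hq.1] at h
  have h1 := Finset.map_injective _ (Finset.geomSum_injective le_rfl h.2)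
  refine hp.1.eq_of_edges_subset hq.1 fun e he => ?_
  rw [← List.mem_toFinset, ← h1]
  simpa using he

theorem IsMinPath.weight_le {a b : V} {p : G.Walk a b} (hp : p.IsMinPath (lexWeight w))
    (q : G.Walk a b) : p.weight w ≤ q.weight w := by
  have := Prod.Lex.monotone_fst _ _ (hp.2 q)
  simpa only [weight_lexWeight, ofLex_toLex] using this

end SimpleGraph.Walk

theorem CrossingVertex.symm {V : Type*} {G : SimpleGraph V} {a b c d : V} {p : G.Walk a b}
    {q : G.Walk c d} {x : V} (h : CrossingVertex G p q x) : CrossingVertex G q p x :=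
  ⟨h.2.1, h.1, h.2.2.symm⟩

theorem crossingVertex_reverse_left {V : Type*} {G : SimpleGraph V} {a b c d : V}
    {p : G.Walk a b} {q : G.Walk c d} {x : V} :
    CrossingVertex G p.reverse q x ↔ CrossingVertex G p q x := by
  simp [CrossingVertex]

theorem not_crossingVertex_self {V : Type*} {G : SimpleGraph V} {a b : V}
    {p : G.Walk a b} {x : V} : ¬ CrossingVertex G p p x :=
  fun h => h.2.2 rfl

/-- A family of walks in which any two members have at most two crossing vertices has few crossing
vertices altogether. -/
theorem ncard_crossingVertex_le {V : Type*} [Fintype V] [DecidableEq V] {G : SimpleGraph V}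
    {P : ∀ a b : V, G.Walk a b} (hrev : ∀ a b : V, P b a = (P a b).reverse)
    (hthree : ∀ {a b c d x y z : V}, CrossingVertex G (P a b) (P c d) x →
      CrossingVertex G (P a b) (P c d) y → CrossingVertex G (P a b) (P c d) z →
      x ≠ y → x ≠ z → y ≠ z → False) (S : Finset V) :
    {x : V | ∃ a ∈ S, ∃ b ∈ S, ∃ c ∈ S, ∃ d ∈ S,
        a ≠ b ∧ c ≠ d ∧ CrossingVertex G (P a b) (P c d) x}.ncard ≤
      S.card.choose 2 * (S.card.choose 2 - 1) := by
  classical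
  have hswap : ∀ {a b c d x : V}, CrossingVertex G (P a b) (P c d) x →
      CrossingVertex G (P b a) (P c d) x := fun {a b c d x} h => by
    rw [hrev a b]; exact crossingVertex_reverse_left.2 h
  have hcongr : ∀ {a b a' b' c d x : V}, s(a, b) = s(a', b') →
      CrossingVertex G (P a b) (P c d) x → CrossingVertex G (P a' b') (P c d) x := by
    intro a b a' b' c d x he h
    rcases Sym2.eq_iff.1 he with ⟨rfl, rfl⟩ | ⟨rfl, rfl⟩
    · exact h
    · exact hswap h
  let T : Finset (Sym2 V) := S.offDiag.image Sym2.mk.uncurry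
  let U : Finset (Sym2 (Sym2 V)) := T.offDiag.image Sym2.mk.uncurry
  let K : Sym2 (Sym2 V) → Finset V := fun t =>
    {x | ∃ a b c d : V, s(s(a, b), s(c, d)) = t ∧ CrossingVertex G (P a b) (P c d) x}
  have hK : ∀ t ∈ U, (K t).card ≤ 2 := by
    intro t _
    induction t using Sym2.ind with | _ e f =>
    induction e using Sym2.ind with | _ a b =>
    induction f using Sym2.ind with | _ c d =>
    have hmem : ∀ {x}, x ∈ K s(s(a, b), s(c, d)) → CrossingVertex G (P a b) (P c d) x := by
      intro x hx
      obtain ⟨a', b', c', d', he, hx⟩ := (Finset.mem_filter.1 hx).2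
      rcases Sym2.eq_iff.1 he with ⟨h1, h2⟩ | ⟨h1, h2⟩
      · exact (hcongr h2 (hcongr h1 hx).symm).symm
      · exact hcongr h2 (hcongr h1 hx).symm
    by_contra! hlt
    obtain ⟨x, hx, y, hy, z, hz, hxy, hxz, hyz⟩ := Finset.two_lt_card.1 hlt
    exact hthree (hmem hx) (hmem hy) (hmem hz) hxy hxz hyz
  have hsub : {x : V | ∃ a ∈ S, ∃ b ∈ S, ∃ c ∈ S, ∃ d ∈ S,
      a ≠ b ∧ c ≠ d ∧ CrossingVertex G (P a b) (P c d) x} ⊆ (U.biUnion K : Finset V) := by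
    rintro x ⟨a, ha, b, hb, c, hc, d, hd, hab, hcd, hx⟩
    have hT : ∀ {a b : V}, a ∈ S → b ∈ S → a ≠ b → s(a, b) ∈ T := fun {a b} ha hb hab =>
      Finset.mem_image.2 ⟨(a, b), Finset.mem_offDiag.2 ⟨ha, hb, hab⟩, rfl⟩
    have hne : s(a, b) ≠ s(c, d) := fun he => not_crossingVertex_self (hcongr he hx)
    refine Finset.mem_coe.2 (Finset.mem_biUnion.2 ⟨s(s(a, b), s(c, d)),
      Finset.mem_image.2 ⟨(s(a, b), s(c, d)),
        Finset.mem_offDiag.2 ⟨hT ha hb hab, hT hc hd hcd, hne⟩, rfl⟩, ?_⟩)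
    exact Finset.mem_filter.2 ⟨Finset.mem_univ _, a, b, c, d, rfl, hx⟩
  calc _ ≤ (U.biUnion K).card := by
        rw [← Set.ncard_coe_finset]; exact Set.ncard_le_ncard hsub (Finset.finite_toSet _)
    _ ≤ U.card * 2 := Finset.card_biUnion_le_card_mul _ _ _ hK
    _ = T.card.choose 2 * 2 := by rw [Sym2.card_image_offDiag]
    _ = T.card * (T.card - 1) := by rw [Nat.choose_two_right, Nat.div_mul_cancel
        (Nat.even_mul_pred_self _).two_dvd]
    _ = _ := by rw [Sym2.card_image_offDiag]

/-- For any finite connected graph with nonnegative real edge weights and any vertex set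
`S`, there is a family of minimum-weight paths between all pairs of distinct vertices of
`S` having at most `C(|S|,2)·(C(|S|,2) − 1)` crossing vertices outside `S`. -/
theorem crossing_vertices {V : Type*} [Fintype V] [DecidableEq V]
    (G : SimpleGraph V) (hconn : G.Connected)
    (w : Sym2 V → ℝ) (hw : ∀ e, 0 ≤ w e) (S : Finset V) :
    ∃ P : ∀ a b : V, G.Walk a b,
      (∀ a b : V, P b a = (P a b).reverse) ∧
      (∀ a ∈ S, ∀ b ∈ S, a ≠ b →
        (P a b).IsPath ∧
          ∀ Q : G.Walk a b, ((P a b).edges.map w).sum ≤ (Q.edges.map w).sum) ∧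
      {x : V | x ∉ S ∧ ∃ a ∈ S, ∃ b ∈ S, ∃ c ∈ S, ∃ d ∈ S,
          a ≠ b ∧ c ≠ d ∧ CrossingVertex G (P a b) (P c d) x}.ncard ≤
        S.card.choose 2 * (S.card.choose 2 - 1) := by
  have hω : ∀ e, 0 ≤ SimpleGraph.Walk.lexWeight w e := fun e =>
    Prod.Lex.toLex_mono (Prod.mk_le_mk.2 ⟨hw e, Nat.zero_le _⟩)
  choose P hP using SimpleGraph.Walk.exists_isMinPath (G := G) hω hconn
  have hrev : ∀ a b : V, P b a = (P a b).reverse := fun a b =>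
    (hP b a).lexWeight_unique (hP a b).reverse
  refine ⟨P, hrev, fun a _ b _ _ => ⟨(hP a b).1, fun Q => (hP a b).weight_le Q⟩, ?_⟩
  refine (Set.ncard_le_ncard (fun x hx => hx.2) (Set.toFinite _)).trans
    (ncard_crossingVertex_le hrev ?_ S)
  intro a b c d x y z
  exact SimpleGraph.Walk.not_three_crossingVertex
    SimpleGraph.Walk.IsMinPath.lexWeight_unique (hP a b) (hP c d)
end

section
/- Let ω ≥ 2 and m ≥ 1 be integers, and let w be a nonnegative real edge-weight function on the width-ω, depth-m grid. Then there exist an integer m' with 1 ≤ m' ≤ ω⁵/4 and a nonnegative real edge-weight function w' on the width-ω, depth-m' grid such that for all 1 ≤ i ≤ j ≤ ω, the w'-distance between the vertices (1, i) and (1, j) in the first row of the depth-m' grid equals the w-distance between the vertices (1, i) and (1, j) in the first row of the depth-m grid. -/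
open scoped ENNReal

open Toll

/-- The width-`ω`, depth-`m` grid graph: vertices are `{1,…,m} × {1,…,ω}` (modelled as
`Fin m × Fin ω`, the first coordinate indexing rows, row `1` being row `0` here), and two
vertices are adjacent iff they differ by exactly `1` in exactly one coordinate. -/
def gridGraph (m ω : ℕ) : SimpleGraph (Fin m × Fin ω) :=
  SimpleGraph.fromRel fun x y =>
    (x.1 = y.1 ∧ x.2.val + 1 = y.2.val) ∨ (x.2 = y.2 ∧ x.1.val + 1 = y.1.val)

section WeightedDistance

variable {V : Type*} {G : SimpleGraph V} {p : Sym2 V → NNReal}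

theorem Toll.walkWeight_append {u v x : V} (a : G.Walk u v) (b : G.Walk v x) :
    walkWeight G p (a.append b) = walkWeight G p a + walkWeight G p b := by
  simp [walkWeight, SimpleGraph.Walk.edges_append]

theorem Toll.walkWeight_reverse {u v : V} (a : G.Walk u v) :
    walkWeight G p a.reverse = walkWeight G p a := by
  simp [walkWeight, SimpleGraph.Walk.edges_reverse]

theorem Toll.gdist_le_walkWeight_s4 {u v : V} (a : G.Walk u v) :
    gdist G p u v ≤ (walkWeight G p a : ℝ≥0∞) :=
  iInf_le _ a

theorem Toll.gdist_self (u : V) : gdist G p u u = 0 :=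
  le_antisymm ((gdist_le_walkWeight_s4 SimpleGraph.Walk.nil).trans (by simp [walkWeight])) bot_le

theorem Toll.gdist_comm (u v : V) : gdist G p u v = gdist G p v u := by
  apply le_antisymm <;> refine le_iInf fun a => ?_ <;>
    exact (gdist_le_walkWeight_s4 a.reverse).trans (by rw [walkWeight_reverse])

theorem Toll.gdist_triangle (u v x : V) :
    gdist G p u x ≤ gdist G p u v + gdist G p v x := by
  refine ENNReal.le_iInf_add_iInf fun a b => ?_
  refine (gdist_le_walkWeight_s4 (a.append b)).trans ?_
  rw [walkWeight_append, ENNReal.coe_add]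

theorem Toll.gdist_le_of_adj {u v : V} (h : G.Adj u v) : gdist G p u v ≤ p s(u, v) :=
  (gdist_le_walkWeight_s4 h.toWalk).trans (by simp [walkWeight])

/-- Exchanging the tails of two walks that meet: if every `a`–`c` walk meets every `b`–`d` walk,
then reconnecting the four endpoints at the meeting points does not increase the distance. -/
theorem Toll.gdist_exchange {a b c d : V}
    (h : ∀ (P : G.Walk a c) (Q : G.Walk b d), ∃ z, z ∈ P.support ∧ z ∈ Q.support) :
    gdist G p a d + gdist G p b c ≤ gdist G p a c + gdist G p b d ∧
      gdist G p a b + gdist G p c d ≤ gdist G p a c + gdist G p b d := by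
  classical
  have key : ∀ (P : G.Walk a c) (Q : G.Walk b d), ∃ z,
      gdist G p a z + gdist G p z c + (gdist G p b z + gdist G p z d) ≤
        walkWeight G p P + walkWeight G p Q := by
    intro P Q
    obtain ⟨z, hP, hQ⟩ := h P Q
    refine ⟨z, ?_⟩
    conv_rhs => rw [← P.take_spec hP, ← Q.take_spec hQ]
    rw [walkWeight_append, walkWeight_append, ENNReal.coe_add, ENNReal.coe_add]
    gcongr <;> exact gdist_le_walkWeight_s4 _
  constructor
  · refine ENNReal.le_iInf_add_iInf fun P Q => ?_
    obtain ⟨z, hz⟩ := key P Q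
    refine le_trans ?_ hz
    refine (add_le_add (gdist_triangle a z d) (gdist_triangle b z c)).trans (le_of_eq ?_)
    ring
  · refine ENNReal.le_iInf_add_iInf fun P Q => ?_
    obtain ⟨z, hz⟩ := key P Q
    refine le_trans ?_ hz
    refine (add_le_add (gdist_triangle a z b) (gdist_triangle c z d)).trans (le_of_eq ?_)
    rw [gdist_comm z b, gdist_comm c z]
    ring

/-- A pseudometric dominated by the edge weights is dominated by the distance. -/
theorem Toll.le_gdist_of_le_weight {ρ : V → V → NNReal} (h_self : ∀ u, ρ u u = 0)
    (h_tri : ∀ u v x, ρ u x ≤ ρ u v + ρ v x) (h_edge : ∀ u v, ρ u v ≤ p s(u, v)) (u v : V) :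
    (ρ u v : ℝ≥0∞) ≤ gdist G p u v := by
  refine le_iInf fun a => ENNReal.coe_le_coe.2 ?_
  induction a with
  | nil => simp [h_self]
  | @cons u v x h q ih =>
    refine (h_tri u v x).trans ?_
    simpa [walkWeight] using add_le_add (h_edge u v) ih

end WeightedDistance

section Crossing

variable {m ω : ℕ}

theorem gridGraph_adj {x y : Fin m × Fin ω} : (gridGraph m ω).Adj x y ↔
    (x.1.val = y.1.val ∧ (x.2.val + 1 = y.2.val ∨ y.2.val + 1 = x.2.val)) ∨
      (x.2.val = y.2.val ∧ (x.1.val + 1 = y.1.val ∨ y.1.val + 1 = x.1.val)) := by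
  simp only [gridGraph, SimpleGraph.fromRel_adj, ne_eq, Prod.ext_iff, Fin.ext_iff]
  omega

/-- The signed traversal by a step `x → y` of the edge between columns `c` and `c + 1`
in some row above row `r`. -/
def stepFlow (x y : Fin m × Fin ω) (r c : ℕ) : ℤ :=
  if x.1.val = y.1.val ∧ x.1.val < r then
    if x.2.val = c ∧ y.2.val = c + 1 then 1
    else if y.2.val = c ∧ x.2.val = c + 1 then -1 else 0
  else 0

/-- The net number of traversals by a walk, from left to right, of the edges between
columns `c` and `c + 1` in the rows above row `r`. -/
def walkFlow {x y : Fin m × Fin ω} (P : (gridGraph m ω).Walk x y) (r c : ℕ) : ℤ :=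
  (P.darts.map fun d => stepFlow d.fst d.snd r c).sum

theorem walkFlow_zero {x y : Fin m × Fin ω} (P : (gridGraph m ω).Walk x y) (c : ℕ) :
    walkFlow P 0 c = 0 := by
  simp [walkFlow, stepFlow]

theorem walkFlow_cons {x y z : Fin m × Fin ω} (h : (gridGraph m ω).Adj x y)
    (P : (gridGraph m ω).Walk y z) (r c : ℕ) :
    walkFlow (P.cons h) r c = stepFlow x y r c + walkFlow P r c := by
  simp [walkFlow]

theorem walkFlow_succ_row {x y : Fin m × Fin ω} (P : (gridGraph m ω).Walk x y) {r c : ℕ}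
    (hP : ∀ z ∈ P.support, ¬(z.1.val = r ∧ z.2.val = c)) :
    walkFlow P (r + 1) c = walkFlow P r c := by
  induction P with
  | nil => simp [walkFlow]
  | @cons x y z h q ih =>
    rw [walkFlow_cons, walkFlow_cons, ih fun z hz => hP z (by simp [hz])]
    have hx := hP x (by simp)
    have hy := hP y (by simp)
    simp only [stepFlow]
    split_ifs <;> omega

theorem walkFlow_succ_col {x y : Fin m × Fin ω} (P : (gridGraph m ω).Walk x y) {r c : ℕ}
    (hP : ∀ z ∈ P.support, ¬(z.1.val = r ∧ z.2.val = c + 1)) :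
    walkFlow P r c - walkFlow P r (c + 1) =
      (if y.1.val < r ∧ y.2.val = c + 1 then 1 else 0) -
        (if x.1.val < r ∧ x.2.val = c + 1 then 1 else 0) := by
  induction P with
  | nil => simp [walkFlow]
  | @cons x y z h q ih =>
    rw [walkFlow_cons, walkFlow_cons]
    have ih' := ih fun z hz => hP z (by simp [hz])
    have hx := hP x (by simp)
    have hy := hP y (by simp)
    rw [gridGraph_adj] at h
    have key : stepFlow x y r c - stepFlow x y r (c + 1) =
        (if y.1.val < r ∧ y.2.val = c + 1 then 1 else 0) -
          (if x.1.val < r ∧ x.2.val = c + 1 then 1 else 0) := by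
      clear ih ih' hP
      simp only [stepFlow]
      split_ifs <;> omega
    linarith

/-- A winding-number type index of a point relative to a walk joining first-row vertices. -/
def walkIndex {x y : Fin m × Fin ω} (P : (gridGraph m ω).Walk x y) (r c : ℕ) : ℤ :=
  walkFlow P r c + (if y.2.val ≤ c then 1 else 0) - (if x.2.val ≤ c then 1 else 0)

theorem walkIndex_succ_col {x y : Fin m × Fin ω} (P : (gridGraph m ω).Walk x y)
    (hx : x.1.val = 0) (hy : y.1.val = 0) {r c : ℕ}
    (hP : ∀ z ∈ P.support, ¬(z.1.val = r ∧ z.2.val = c + 1)) :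
    walkIndex P r (c + 1) = walkIndex P r c := by
  have h := walkFlow_succ_col P hP
  have h1 := hP x (by simp)
  have h2 := hP y (by simp)
  simp only [walkIndex]
  split_ifs at h ⊢ <;> omega

theorem walkIndex_eq_of_disjoint {x y u v : Fin m × Fin ω} (P : (gridGraph m ω).Walk x y)
    (hx : x.1.val = 0) (hy : y.1.val = 0) (Q : (gridGraph m ω).Walk u v)
    (hPQ : ∀ z ∈ P.support, z ∉ Q.support) :
    walkIndex P u.1 u.2 = walkIndex P v.1 v.2 := by
  induction Q with
  | nil => rfl
  | @cons u v z h q ih =>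
    rw [← ih fun z hz hq => hPQ z hz (by simp [hq])]
    have avoid : ∀ t ∈ (q.cons h).support, ∀ z ∈ P.support,
        ¬(z.1.val = t.1.val ∧ z.2.val = t.2.val) := by
      rintro t ht z hz ⟨h1, h2⟩
      have : z = t := Prod.ext (Fin.ext h1) (Fin.ext h2)
      exact hPQ z hz (this ▸ ht)
    have hu := avoid u (by simp)
    have hv := avoid v (by simp)
    rw [gridGraph_adj] at h
    rcases h with ⟨h1, h2 | h2⟩ | ⟨h1, h2 | h2⟩
    · rw [← h2, ← h1] at hv ⊢
      exact (walkIndex_succ_col P hx hy hv).symm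
    · rw [← h2, h1] at hu ⊢
      exact walkIndex_succ_col P hx hy hu
    · rw [← h2, ← h1]
      simp only [walkIndex, walkFlow_succ_row P hu]
    · rw [← h2, h1]
      simp only [walkIndex, walkFlow_succ_row P hv]

/-- Planarity of the grid: walks joining interleaved pairs of first-row vertices meet. -/
theorem exists_mem_support_of_interleaved {a b c d : Fin m × Fin ω}
    (ha : a.1.val = 0) (hb : b.1.val = 0) (hc : c.1.val = 0) (hd : d.1.val = 0)
    (hab : a.2 ≤ b.2) (hbc : b.2 ≤ c.2) (hcd : c.2 ≤ d.2)
    (P : (gridGraph m ω).Walk a c) (Q : (gridGraph m ω).Walk b d) :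
    ∃ z, z ∈ P.support ∧ z ∈ Q.support := by
  by_contra! hPQ
  have h := walkIndex_eq_of_disjoint P ha hc Q hPQ
  have ne : ∀ x y : Fin m × Fin ω, x.1.val = 0 → y.1.val = 0 → x ≠ y → x.2.val ≠ y.2.val :=
    fun x y hx hy hxy h => hxy (Prod.ext (Fin.ext (hx.trans hy.symm)) (Fin.ext h))
  have h1 := ne a b ha hb (by rintro rfl; exact hPQ a (by simp) (by simp))
  have h2 := ne c b hc hb (by rintro rfl; exact hPQ c (by simp) (by simp))
  have h3 := ne c d hc hd (by rintro rfl; exact hPQ c (by simp) (by simp))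
  rw [Fin.le_def] at hab hbc hcd
  simp only [walkIndex, hb, hd, walkFlow_zero] at h
  split_ifs at h <;> omega

end Crossing

section Distances

variable {m ω : ℕ}

theorem gdist_row_ne_top (w : Sym2 (Fin m × Fin ω) → NNReal) (r : Fin m) {i j : Fin ω}
    (hij : i ≤ j) : gdist (gridGraph m ω) w (r, i) (r, j) ≠ ⊤ := by
  obtain ⟨j, hj⟩ := j
  induction j with
  | zero =>
    obtain rfl : i = ⟨0, hj⟩ := le_antisymm hij (Fin.mk_le_of_le_val (Nat.zero_le _))
    simp [gdist_self]
  | succ j ih =>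
    rcases hij.eq_or_lt with rfl | hlt
    · simp [gdist_self]
    · have h := ih (by omega) (Fin.le_def.2 (Nat.lt_succ_iff.1 (Fin.lt_def.1 hlt)))
      refine ne_top_of_le_ne_top (ENNReal.add_ne_top.2 ⟨h, ?_⟩) (gdist_triangle _ _ _)
      exact ne_top_of_le_ne_top ENNReal.coe_ne_top
        (gdist_le_of_adj (by rw [gridGraph_adj]; simp))

/-- The distance between two vertices of the first row, as a real function of natural numbers. -/
noncomputable def rowDist (hm : 1 ≤ m) (w : Sym2 (Fin m × Fin ω) → NNReal) (a b : ℕ) : ℝ :=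
  if h : a < ω ∧ b < ω then
    (gdist (gridGraph m ω) w (⟨0, hm⟩, ⟨a, h.1⟩) (⟨0, hm⟩, ⟨b, h.2⟩)).toReal
  else 0

theorem rowDist_self (hm : 1 ≤ m) (w : Sym2 (Fin m × Fin ω) → NNReal) (a : ℕ) :
    rowDist hm w a a = 0 := by
  simp [rowDist, gdist_self]

theorem rowDist_comm (hm : 1 ≤ m) (w : Sym2 (Fin m × Fin ω) → NNReal) (a b : ℕ) :
    rowDist hm w a b = rowDist hm w b a := by
  unfold rowDist
  split_ifs <;> first | rfl | omega | rw [gdist_comm]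

/-- The Kalmanson inequalities. -/
theorem rowDist_kalmanson (hm : 1 ≤ m) (w : Sym2 (Fin m × Fin ω) → NNReal) {a b c d : ℕ}
    (hab : a ≤ b) (hbc : b ≤ c) (hcd : c ≤ d) (hd : d < ω) :
    rowDist hm w a d + rowDist hm w b c ≤ rowDist hm w a c + rowDist hm w b d ∧
      rowDist hm w a b + rowDist hm w c d ≤ rowDist hm w a c + rowDist hm w b d := by
  have ha : a < ω := by omega
  have hb : b < ω := by omega
  have hc : c < ω := by omega
  have fin : ∀ i j : Fin ω, i ≤ j →
      gdist (gridGraph m ω) w (⟨0, hm⟩, i) (⟨0, hm⟩, j) ≠ ⊤ :=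
    fun i j h => gdist_row_ne_top w _ h
  have key := gdist_exchange (p := w) (exists_mem_support_of_interleaved (m := m) (ω := ω)
    (a := (⟨0, hm⟩, ⟨a, ha⟩)) (b := (⟨0, hm⟩, ⟨b, hb⟩)) (c := (⟨0, hm⟩, ⟨c, hc⟩))
    (d := (⟨0, hm⟩, ⟨d, hd⟩)) rfl rfl rfl rfl (by simpa) (by simpa) (by simpa))
  have hac := fin ⟨a, ha⟩ ⟨c, hc⟩ (Fin.mk_le_mk.2 (by omega))
  have hbd := fin ⟨b, hb⟩ ⟨d, hd⟩ (Fin.mk_le_mk.2 (by omega))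
  have had := fin ⟨a, ha⟩ ⟨d, hd⟩ (Fin.mk_le_mk.2 (by omega))
  have hbc' := fin ⟨b, hb⟩ ⟨c, hc⟩ (Fin.mk_le_mk.2 (by omega))
  have hab' := fin ⟨a, ha⟩ ⟨b, hb⟩ (Fin.mk_le_mk.2 (by omega))
  have hcd' := fin ⟨c, hc⟩ ⟨d, hd⟩ (Fin.mk_le_mk.2 (by omega))
  simp only [rowDist, ha, hb, hc, hd, and_self, dite_true]
  rw [← ENNReal.toReal_add had hbc', ← ENNReal.toReal_add hac hbd,
    ← ENNReal.toReal_add hab' hcd']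
  exact ⟨ENNReal.toReal_mono (ENNReal.add_ne_top.2 ⟨hac, hbd⟩) key.1,
    ENNReal.toReal_mono (ENNReal.add_ne_top.2 ⟨hac, hbd⟩) key.2⟩

end Distances

section CutGrid

/-- The cut of the grid cutting off columns `q.1 < c ≤ q.2` down to depth `q.2 - q.1`. -/
def InCut (q : ℕ × ℕ) (r c : ℕ) : Prop :=
  r + q.1 < q.2 ∧ q.1 < c ∧ c ≤ q.2

instance (q : ℕ × ℕ) (r c : ℕ) : Decidable (InCut q r c) :=
  inferInstanceAs (Decidable (_ ∧ _))

/-- The total `α`-weight of the cuts separating two points. -/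
def cutDist (ω : ℕ) (α : ℕ × ℕ → NNReal) (r c r' c' : ℕ) : NNReal :=
  ∑ q ∈ Finset.range ω ×ˢ Finset.range ω, if InCut q r c ↔ InCut q r' c' then 0 else α q

variable {ω : ℕ} {α : ℕ × ℕ → NNReal}

theorem cutDist_self (r c : ℕ) : cutDist ω α r c r c = 0 := by
  simp [cutDist]

theorem cutDist_comm (r c r' c' : ℕ) : cutDist ω α r c r' c' = cutDist ω α r' c' r c := by
  simp only [cutDist, iff_comm]

theorem cutDist_triangle (r c r' c' r'' c'' : ℕ) :
    cutDist ω α r c r'' c'' ≤ cutDist ω α r c r' c' + cutDist ω α r' c' r'' c'' := by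
  simp only [cutDist, ← Finset.sum_add_distrib]
  refine Finset.sum_le_sum fun q _ => ?_
  split_ifs <;> first | (exfalso; tauto) | simp

/-- The cut distance is additive along any point separated from the first endpoint only by cuts
that separate both endpoints. -/
theorem cutDist_add {r c r' c' r'' c'' : ℕ}
    (h : ∀ q, (InCut q r c ↔ InCut q r'' c'') → (InCut q r c ↔ InCut q r' c')) :
    cutDist ω α r c r' c' + cutDist ω α r' c' r'' c'' = cutDist ω α r c r'' c'' := by
  simp only [cutDist, ← Finset.sum_add_distrib]
  refine Finset.sum_congr rfl fun q _ => ?_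
  have := h q
  split_ifs <;> first | (exfalso; tauto) | simp

/-- The edge weights of the grid for which the cut distance is the weight of an edge. -/
def cutWeight (ω m : ℕ) (α : ℕ × ℕ → NNReal) : Sym2 (Fin m × Fin ω) → NNReal :=
  Sym2.lift ⟨fun x y => cutDist ω α x.1 x.2 y.1 y.2, fun _ _ => cutDist_comm _ _ _ _⟩

variable {m : ℕ}

theorem cutDist_le_gdist (x y : Fin m × Fin ω) :
    (cutDist ω α x.1 x.2 y.1 y.2 : ℝ≥0∞) ≤ gdist (gridGraph m ω) (cutWeight ω m α) x y :=
  le_gdist_of_le_weight (ρ := fun x y : Fin m × Fin ω => cutDist ω α x.1 x.2 y.1 y.2)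
    (fun _ => cutDist_self _ _) (fun _ _ _ => cutDist_triangle _ _ _ _ _ _)
    (fun _ _ => le_rfl) x y

theorem gdist_cutWeight_step {x y z : Fin m × Fin ω} (hyz : (gridGraph m ω).Adj y z)
    (hxy : gdist (gridGraph m ω) (cutWeight ω m α) x y ≤ cutDist ω α x.1 x.2 y.1 y.2)
    (h : ∀ q, (InCut q x.1 x.2 ↔ InCut q z.1 z.2) → (InCut q x.1 x.2 ↔ InCut q y.1 y.2)) :
    gdist (gridGraph m ω) (cutWeight ω m α) x z ≤ cutDist ω α x.1 x.2 z.1 z.2 := by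
  refine (gdist_triangle x y z).trans ((add_le_add hxy (gdist_le_of_adj hyz)).trans ?_)
  rw [← cutDist_add h, ENNReal.coe_add]
  rfl

theorem gdist_cutWeight_col (hm : 0 < m) (c : Fin ω) (r : ℕ) (hr : r < m) :
    gdist (gridGraph m ω) (cutWeight ω m α) (⟨0, hm⟩, c) (⟨r, hr⟩, c) ≤
      cutDist ω α 0 c r c := by
  induction r with
  | zero => simp [gdist_self]
  | succ r ih =>
    refine gdist_cutWeight_step (by rw [gridGraph_adj]; simp) (ih (by omega)) fun q => ?_
    simp only [InCut]
    omega

theorem gdist_cutWeight_row (r : Fin m) (c k : ℕ) (hk : k ≤ r) (hc : c + k < ω) :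
    gdist (gridGraph m ω) (cutWeight ω m α) (r, ⟨c, by omega⟩) (r, ⟨c + k, hc⟩) ≤
      cutDist ω α r c r (c + k : ℕ) := by
  induction k with
  | zero => simp [gdist_self]
  | succ k ih =>
    refine gdist_cutWeight_step (y := (r, ⟨c + k, by omega⟩))
      (by rw [gridGraph_adj]; simp [add_assoc]) (ih (by omega) (by omega)) fun q => ?_
    simp only [InCut]
    omega

/-- In a sufficiently deep grid the cut distance is realised between first-row vertices. -/
theorem gdist_cutWeight_eq (hm : 0 < m) {i j : Fin ω} (hij : i ≤ j) (hj : j.val < m) :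
    gdist (gridGraph m ω) (cutWeight ω m α) (⟨0, hm⟩, i) (⟨0, hm⟩, j) =
      cutDist ω α 0 i 0 j := by
  refine le_antisymm ?_ (cutDist_le_gdist _ _)
  obtain ⟨k, hk⟩ := Nat.exists_eq_add_of_le (Fin.le_def.1 hij)
  have hkm : k < m := by omega
  have h1 := gdist_cutWeight_col (α := α) hm i k hkm
  have h2 := gdist_cutWeight_row (α := α) (ω := ω) (⟨k, hkm⟩ : Fin m) i k le_rfl (hk ▸ j.isLt)
  have h3 := gdist_cutWeight_col (α := α) hm j k hkm
  simp only [← hk, Fin.eta] at h2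
  rw [gdist_comm, cutDist_comm] at h3
  rw [← cutDist_add (r' := k) (c' := i), ← cutDist_add (r := k) (c := i) (r' := k) (c' := j)]
  · rw [ENNReal.coe_add, ENNReal.coe_add]
    exact (gdist_triangle _ (⟨k, hkm⟩, i) _).trans
      (add_le_add h1 ((gdist_triangle _ (⟨k, hkm⟩, j) _).trans (add_le_add h2 h3)))
  all_goals
    intro q
    simp only [InCut]
    omega

end CutGrid

section Decomposition

theorem sum_range_ite_sub (g : ℕ → ℝ) {a b N : ℕ} (hab : a ≤ b) (hb : b ≤ N) :
    ∑ p ∈ Finset.range N, (if a ≤ p ∧ p < b then g (p + 1) - g p else 0) = g b - g a := by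
  rw [← Finset.sum_filter, ← Finset.sum_Ico_sub g hab]
  congr 1
  ext p
  simp only [Finset.mem_filter, Finset.mem_range, Finset.mem_Ico]
  omega

theorem sum_rectangle_mixed_difference (F : ℕ → ℕ → ℝ) {a b c d N : ℕ} (hab : a ≤ b)
    (hb : b ≤ N) (hcd : c ≤ d) (hd : d ≤ N) :
    ∑ q ∈ Finset.range N ×ˢ Finset.range N,
      (if (a ≤ q.1 ∧ q.1 < b) ∧ (c ≤ q.2 ∧ q.2 < d) then
        F (q.1 + 1) (q.2 + 1) - F q.1 (q.2 + 1) - (F (q.1 + 1) q.2 - F q.1 q.2) else 0) =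
      F b d - F a d - (F b c - F a c) := by
  rw [Finset.sum_product]
  have inner : ∀ p ∈ Finset.range N, ∑ q ∈ Finset.range N,
      (if (a ≤ p ∧ p < b) ∧ (c ≤ q ∧ q < d) then
        F (p + 1) (q + 1) - F p (q + 1) - (F (p + 1) q - F p q) else 0) =
      if a ≤ p ∧ p < b then (F (p + 1) d - F (p + 1) c) - (F p d - F p c) else 0 := by
    intro p _
    by_cases hp : a ≤ p ∧ p < b
    · simp only [hp, and_self, true_and, if_true]
      rw [sum_range_ite_sub (fun q => F (p + 1) q - F p q) hcd hd]
      ring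
    · simp [hp]
  rw [Finset.sum_congr rfl inner, sum_range_ite_sub (fun p => F p d - F p c) hab hb]
  ring

/-- Kalmanson metrics are nonnegative combinations of cuts into circular intervals. -/
theorem exists_cutDist_eq {ω : ℕ} (D : ℕ → ℕ → ℝ) (h_self : ∀ a, D a a = 0)
    (h_comm : ∀ a b, D a b = D b a)
    (h_kal : ∀ a b c d, a ≤ b → b ≤ c → c ≤ d → d < ω →
      D a d + D b c ≤ D a c + D b d ∧ D a b + D c d ≤ D a c + D b d) :
    ∃ α : ℕ × ℕ → NNReal, ∀ i j, i ≤ j → j < ω → (cutDist ω α 0 i 0 j : ℝ) = D i j := by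
  set F : ℕ → ℕ → ℝ := fun a b => D a (if b = ω then 0 else b) with hF
  set β : ℕ × ℕ → ℝ := fun q =>
    F (q.1 + 1) (q.2 + 1) - F q.1 (q.2 + 1) - (F (q.1 + 1) q.2 - F q.1 q.2) with hβ
  have hβ_nonneg : ∀ q : ℕ × ℕ, q.1 < q.2 → q.2 < ω → 0 ≤ β q := by
    rintro ⟨a, b⟩ hab hb
    dsimp only at hab hb
    by_cases h : b + 1 = ω
    · have h1 := (h_kal 0 a (a + 1) b (by omega) (by omega) (by omega) hb).2
      simp only [hβ, hF, h, hb.ne, if_true, if_false, h_comm _ 0]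
      linarith
    · have h1 := (h_kal a (a + 1) b (b + 1) (by omega) (by omega) (by omega) (by omega)).1
      simp only [hβ, hF, h, hb.ne, if_false]
      linarith
  refine ⟨fun q => (β q / 2).toNNReal, fun i j hij hj => ?_⟩
  have split : (cutDist ω (fun q => (β q / 2).toNNReal) 0 i 0 j : ℝ) =
      (∑ q ∈ Finset.range ω ×ˢ Finset.range ω,
        (if (0 ≤ q.1 ∧ q.1 < i) ∧ (i ≤ q.2 ∧ q.2 < j) then β q else 0) +
      ∑ q ∈ Finset.range ω ×ˢ Finset.range ω,
        (if (i ≤ q.1 ∧ q.1 < j) ∧ (j ≤ q.2 ∧ q.2 < ω) then β q else 0)) / 2 := by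
    rw [cutDist, NNReal.coe_sum, ← Finset.sum_add_distrib, Finset.sum_div]
    refine Finset.sum_congr rfl fun q hq => ?_
    rw [Finset.mem_product, Finset.mem_range, Finset.mem_range] at hq
    by_cases hlt : q.1 < q.2
    · have hcoe := Real.coe_toNNReal _ (div_nonneg (hβ_nonneg q hlt hq.2) zero_le_two)
      have hq2 := hq.2
      split_ifs with h <;> simp only [InCut] at h <;> first | (exfalso; omega) | simp [hcoe]
    · split_ifs with h <;> simp only [InCut] at h <;> first | (exfalso; omega) | simp
  rw [split, sum_rectangle_mixed_difference F (Nat.zero_le i) (by omega) hij hj.le,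
    sum_rectangle_mixed_difference F hij hj.le hj.le le_rfl]
  have hi : i ≠ ω := by omega
  simp only [hF, hj.ne, hi, if_true, if_false, h_self, h_comm _ 0]
  ring

end Decomposition

/-- **Grid compression.** Any nonnegatively weighted width-`ω`, depth-`m` grid can be
replaced by a weighted grid of the same width and depth at most `ω⁵/4` preserving all
distances between vertices of the first row. -/
theorem grid_compression (ω m : ℕ) (hω : 2 ≤ ω) (hm : 1 ≤ m)
    (w : Sym2 (Fin m × Fin ω) → NNReal) :
    ∃ (m' : ℕ) (hm' : 1 ≤ m'), (m' : ℝ) ≤ (ω : ℝ) ^ 5 / 4 ∧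
      ∃ w' : Sym2 (Fin m' × Fin ω) → NNReal,
        ∀ i j : Fin ω, i ≤ j →
          gdist (gridGraph m' ω) w' (⟨0, by omega⟩, i) (⟨0, by omega⟩, j) =
            gdist (gridGraph m ω) w (⟨0, by omega⟩, i) (⟨0, by omega⟩, j) := by
  obtain ⟨α, hα⟩ := exists_cutDist_eq (rowDist hm w) (rowDist_self hm w) (rowDist_comm hm w)
    fun _ _ _ _ => rowDist_kalmanson hm w
  refine ⟨ω, by omega, ?_, cutWeight ω ω α, fun i j hij => ?_⟩
  · have h2 : (2 : ℝ) ≤ ω := by exact_mod_cast hω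
    have h4 : (2 : ℝ) ^ 4 ≤ (ω : ℝ) ^ 4 := by gcongr
    nlinarith
  · rw [gdist_cutWeight_eq (by omega) hij j.isLt]
    have h := hα i j hij j.isLt
    simp only [rowDist, i.isLt, j.isLt, and_self, dite_true, Fin.eta] at h
    rw [← ENNReal.ofReal_toReal (gdist_row_ne_top w ⟨0, hm⟩ hij), ← h, ENNReal.ofReal_coe_nnreal]
end

section
/- Let G = (V, E) be a finite undirected graph with |E| ≥ 1 and B a nonempty finite multiset of drivers such that every driver (u, v, b) ∈ B has u ≠ v and u, v in the same connected component of G. Then there exists a single price p ≥ 0 such that the uniform pricing assigning price p to every edge achieves revenue at least OPT / (4 · (log₂|E| + log₂|B| + 1)). -/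
open scoped ENNReal

open Toll
namespace Toll

/-- If every threshold `t a` satisfies `t a * ∑_{t i ≥ t a} w i ≤ R`, then the weighted sum of the
thresholds exceeds `R` by at most a factor logarithmic in the total weight. -/
theorem sum_mul_le_of_threshold_le {ι : Type*} [DecidableEq ι] (w t : ι → ℝ) (R : ℝ)
    (hR : 0 ≤ R) (ht : ∀ i, 0 ≤ t i) (hw : ∀ i, 1 ≤ w i) (s : Finset ι) :
    (∀ a ∈ s, t a * ∑ i ∈ s with t a ≤ t i, w i ≤ R) →
      ∑ i ∈ s, w i * t i ≤ R * (1 + Real.log (∑ i ∈ s, w i)) := by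
  induction s using Finset.induction_on_min_value t with
  | empty => simpa using hR
  | insert a s has hmin ih =>
    intro h
    have hsub : ∀ b ∈ s, t b * ∑ i ∈ s with t b ≤ t i, w i ≤ R := fun b hb =>
      (mul_le_mul_of_nonneg_left
        (Finset.sum_le_sum_of_subset_of_nonneg
          (Finset.filter_subset_filter _ (Finset.subset_insert a s))
          fun i _ _ => zero_le_one.trans (hw i)) (ht b)).trans
        (h b (Finset.mem_insert_of_mem hb))
    have hs := ih hsub
    have ha := h a (Finset.mem_insert_self a s)
    rw [Finset.filter_true_of_mem (by simpa using hmin)] at ha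
    rw [Finset.sum_insert has] at ha ⊢
    rw [Finset.sum_insert has]
    have hwa := hw a
    rcases s.eq_empty_or_nonempty with rfl | ⟨b, hb⟩
    · simp only [Finset.sum_empty, add_zero] at ha ⊢
      nlinarith [mul_nonneg hR (Real.log_nonneg hwa)]
    · set W := ∑ i ∈ s, w i
      have hW : 1 ≤ W := (hw b).trans
        (Finset.single_le_sum (fun i _ => zero_le_one.trans (hw i)) hb)
      have hpos : 0 < w a + W := by linarith
      have hlog : w a / (w a + W) ≤ Real.log (w a + W) - Real.log W := by
        have := Real.log_le_sub_one_of_pos (show 0 < W / (w a + W) by positivity)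
        rw [Real.log_div (by positivity) hpos.ne'] at this
        have : w a / (w a + W) = 1 - W / (w a + W) := by field_simp; ring
        linarith
      have hta : w a * t a ≤ R * (w a / (w a + W)) := by
        rw [← mul_div_assoc, le_div_iff₀ hpos]
        nlinarith
      nlinarith [mul_le_mul_of_nonneg_left hlog hR]

variable {V : Type*}

theorem walkWeight_const (G : SimpleGraph V) (p : NNReal) {u v : V} (wk : G.Walk u v) :
    walkWeight G (fun _ => p) wk = wk.length * p := by
  simp [walkWeight]

theorem gdist_const (G : SimpleGraph V) (p : NNReal) {u v : V} (h : G.Reachable u v) :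
    gdist G (fun _ => p) u v = ((G.dist u v * p : NNReal) : ℝ≥0∞) := by
  apply le_antisymm
  · obtain ⟨wk, hwk⟩ := h.exists_walk_length_eq_dist
    exact (iInf_le _ wk).trans (by rw [walkWeight_const, hwk])
  · refine le_iInf fun wk => ?_
    rw [walkWeight_const]
    have := G.dist_le wk
    gcongr

theorem dist_le_card_edgeFinset [Fintype V] [DecidableEq V] (G : SimpleGraph V)
    [DecidableRel G.Adj] {u v : V} (h : G.Reachable u v) :
    G.dist u v ≤ G.edgeFinset.card := by
  obtain ⟨wk, hp, hwk⟩ := h.exists_path_of_dist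
  exact hwk ▸ hp.isTrail.length_le_card_edgeFinset

theorem OPT_le_sum_budgets (G : SimpleGraph V) (B : Multiset (V × V × NNReal)) :
    OPT G B ≤ (B.map fun d => (d.2.2 : ℝ≥0∞)).sum := by
  refine iSup_le fun p => Multiset.sum_map_le_sum_map _ _ fun d _ => ?_
  split_ifs with h
  · exact h
  · exact zero_le

theorem sum_map_eq_sum_coe {α M : Type*} [DecidableEq α] [AddCommMonoid M] (B : Multiset α)
    (f : α → M) : (B.map f).sum = ∑ i : B, f i := by
  rw [Finset.sum, Multiset.map_univ]

end Toll

/-- **Single-price approximation.** Some uniform price `p` on all edges achieves revenue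
at least `OPT / (4·(log₂|E| + log₂|B| + 1))`. -/
theorem single_price_approx {V : Type*} [Fintype V] [DecidableEq V]
    (G : SimpleGraph V) [DecidableRel G.Adj]
    (B : Multiset (V × V × NNReal))
    (hE : 1 ≤ G.edgeFinset.card) (hB : B ≠ 0)
    (hdrivers : ∀ d ∈ B, d.1 ≠ d.2.1 ∧ G.Reachable d.1 d.2.1) :
    ∃ p : NNReal,
      OPT G B /
          ENNReal.ofReal
            (4 * (Real.logb 2 G.edgeFinset.card + Real.logb 2 (Multiset.card B) + 1)) ≤
        rev G B (fun _ => p) := by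
  classical
  have hcard : 1 ≤ Multiset.card B := Multiset.card_pos.mpr hB
  have hmem : ∀ i : B, (i : V × V × NNReal) ∈ B := fun i => Multiset.coe_mem
  let w : B → NNReal := fun i => G.dist i.1.1 i.1.2.1
  let t : B → NNReal := fun i => i.1.2.2 / w i
  have hw : ∀ i, 1 ≤ w i := fun i => by
    simp only [w]
    exact_mod_cast (hdrivers _ (hmem i)).2.pos_dist_of_ne (hdrivers _ (hmem i)).1
  have hwt : ∀ i, w i * t i = i.1.2.2 := fun i =>
    mul_div_cancel₀ _ (zero_lt_one.trans_le (hw i)).ne'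
  let ρ : NNReal → NNReal := fun p => p * ∑ i with p ≤ t i, w i
  have hrev : ∀ p, rev G B (fun _ => p) = (ρ p : ℝ≥0∞) := fun p => by
    rw [rev, sum_map_eq_sum_coe]
    simp only [ρ, Finset.mul_sum, Finset.sum_filter, ENNReal.ofNNReal_finsetSum]
    refine Finset.sum_congr rfl fun i _ => ?_
    simp only [gdist_const G p (hdrivers _ (hmem i)).2, ENNReal.coe_le_coe]
    have hiff : G.dist i.1.1 i.1.2.1 * p ≤ i.1.2.2 ↔ p ≤ t i := by
      rw [← hwt i]
      exact mul_le_mul_iff_right₀ (zero_lt_one.trans_le (hw i))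
    simp only [hiff, w]
    split_ifs <;> simp [mul_comm]
  have : Nonempty B := by
    rw [← Fintype.card_pos_iff, Multiset.card_coe]
    exact hcard
  obtain ⟨a, ha⟩ := Finite.exists_max fun i => ρ (t i)
  refine ⟨t a, ?_⟩
  rw [hrev]
  set L := Real.logb 2 G.edgeFinset.card + Real.logb 2 (Multiset.card B) with hLdef
  have hm : (1 : ℝ) ≤ G.edgeFinset.card := by exact_mod_cast hE
  have hn : (1 : ℝ) ≤ Multiset.card B := by exact_mod_cast hcard
  have hL : 0 ≤ L := add_nonneg (Real.logb_nonneg one_lt_two hm) (Real.logb_nonneg one_lt_two hn)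
  have hlogb : ∀ x : ℝ, 1 ≤ x → Real.log x ≤ Real.logb 2 x := fun x hx =>
    le_div_self (Real.log_nonneg hx) (Real.log_pos one_lt_two)
      (by linarith [Real.log_two_lt_d9])
  have hsum : ((∑ i : B, i.1.2.2 : NNReal) : ℝ) ≤ ρ (t a) * (1 + L) := by
    have key := sum_mul_le_of_threshold_le (fun i => (w i : ℝ)) (fun i => (t i : ℝ)) (ρ (t a))
      (ρ (t a)).2 (fun i => (t i).2) (fun i => by exact_mod_cast hw i) Finset.univ
      (fun i _ => by exact_mod_cast ha i)
    have hW : ∑ i, (w i : ℝ) ≤ Multiset.card B * G.edgeFinset.card := by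
      have : ∀ i ∈ (Finset.univ : Finset B), (w i : ℝ) ≤ G.edgeFinset.card := fun i _ => by
        simp only [w]
        exact_mod_cast dist_le_card_edgeFinset G (hdrivers _ (hmem i)).2
      simpa using Finset.sum_le_card_nsmul _ _ _ this
    have hWpos : 0 < ∑ i, (w i : ℝ) :=
      Finset.sum_pos (fun i _ => by exact_mod_cast zero_lt_one.trans_le (hw i))
        Finset.univ_nonempty
    have hlog : Real.log (∑ i, (w i : ℝ)) ≤ L := by
      refine (Real.log_le_log hWpos hW).trans ?_
      rw [Real.log_mul (by positivity) (by positivity)]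
      linarith [hlogb _ hm, hlogb _ hn]
    calc ((∑ i : B, i.1.2.2 : NNReal) : ℝ) = ∑ i, (w i : ℝ) * t i := by
          push_cast
          exact Finset.sum_congr rfl fun i _ => by exact_mod_cast (hwt i).symm
      _ ≤ _ := key.trans (by gcongr)
  refine ENNReal.div_le_of_le_mul ((OPT_le_sum_budgets G B).trans ?_)
  rw [sum_map_eq_sum_coe, ← ENNReal.ofNNReal_finsetSum, ← ENNReal.ofReal_coe_nnreal,
    ← ENNReal.ofReal_coe_nnreal, ← ENNReal.ofReal_mul (NNReal.coe_nonneg _)]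
  refine ENNReal.ofReal_le_ofReal (hsum.trans ?_)
  gcongr
  linarith
end

section
/- Let G = (V, E) be a finite undirected graph and B a nonempty finite multiset of drivers such that every driver (u, v, b) ∈ B has u ≠ v and u, v in the same connected component of G, and let b_max = max_{(u,v,b)∈B} b. For every integer k ≥ 0, the uniform pricing with price p = b_max/2^{k+1} achieves revenue at least (1/2) · Σ b, where the sum ranges over all drivers (u, v, b) ∈ B with b/hop(u, v) ∈ ( b_max/2^{k+1}, b_max/2^k ]. -/
open scoped ENNReal

open Toll

/-- Under a uniform pricing, the distance is the hop count times the price. -/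
theorem Toll.gdist_const_s10 {V : Type*} {G : SimpleGraph V} {u v : V} (h : G.Reachable u v)
    (c : NNReal) : gdist G (fun _ => c) u v = ((G.dist u v * c : NNReal) : ℝ≥0∞) := by
  have weight (w : G.Walk u v) : walkWeight G (fun _ => c) w = w.length * c := by
    simp [walkWeight]
  apply le_antisymm
  · obtain ⟨w, hw⟩ := h.exists_walk_length_eq_dist
    exact (iInf_le _ w).trans_eq (by rw [weight, hw])
  · refine le_iInf fun w => ?_
    rw [weight]
    have := SimpleGraph.dist_le w
    gcongr

/-- A termwise lower bound on the elements satisfying `P` bounds the sum over the whole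
multiset from below. -/
theorem Multiset.sum_map_filter_div_two_le {α : Type*} (S : Multiset α) (P : α → Prop)
    [DecidablePred P] (f g : α → ℝ≥0∞)
    (h : ∀ a ∈ S, P a → f a / 2 ≤ g a) :
    ((S.filter P).map f).sum / 2 ≤ (S.map g).sum := by
  induction S using Multiset.induction with
  | empty => simp
  | cons a S ih =>
    have tail := ih fun b hb => h b (Multiset.mem_cons_of_mem hb)
    by_cases ha : P a
    · have head := h a (Multiset.mem_cons_self a S) ha
      simpa [ha, ENNReal.add_div] using add_le_add head tail
    · simpa [ha] using tail.trans le_add_self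

/-- The uniform pricing with price `b_max/2^(k+1)` earns at least half of the total
budget of the drivers whose ratio `b/hop(u,v)` lies in `(b_max/2^(k+1), b_max/2^k]`. -/
theorem bucket_revenue {V : Type*} [Fintype V] [DecidableEq V]
    (G : SimpleGraph V) [DecidableRel G.Adj]
    (B : Multiset (V × V × NNReal)) (hB : B ≠ 0)
    (hdrivers : ∀ d ∈ B, d.1 ≠ d.2.1 ∧ G.Reachable d.1 d.2.1) (k : ℕ) :
    (((B.filter fun d =>
          bmax B / 2 ^ (k + 1) < d.2.2 / (G.dist d.1 d.2.1 : NNReal) ∧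
            d.2.2 / (G.dist d.1 d.2.1 : NNReal) ≤ bmax B / 2 ^ k).map
        fun d => d.2.2).sum : ℝ≥0∞) / 2 ≤
      rev G B (fun _ => bmax B / 2 ^ (k + 1)) := by
  apply Multiset.sum_map_filter_div_two_le
  rintro ⟨u, v, b⟩ hd ⟨hlo, hhi⟩
  obtain ⟨hne, hr⟩ := hdrivers _ hd
  simp only at hne hr hlo hhi ⊢
  have hpos : (0 : NNReal) < G.dist u v := by exact_mod_cast hr.pos_dist_of_ne hne
  rw [gdist_const_s10 hr, if_pos]
  · rw [div_le_iff₀ hpos] at hhi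
    have hhalf : b / 2 ≤ G.dist u v * (bmax B / 2 ^ (k + 1)) :=
      calc b / 2 ≤ bmax B / 2 ^ k * G.dist u v / 2 := by gcongr
        _ = G.dist u v * (bmax B / 2 ^ (k + 1)) := by rw [pow_succ]; field_simp
    have := ENNReal.coe_le_coe.2 hhalf
    rwa [ENNReal.coe_div two_ne_zero] at this
  · rw [lt_div_iff₀ hpos, mul_comm] at hlo
    exact_mod_cast hlo.le
end

section
/- Let G = (V, E) be a finite undirected graph and B a finite multiset of drivers partitioned as B = B_1 ⊎ B_2 ⊎ … ⊎ B_k. Let c ≥ 1, and for each j let p_j be a pricing whose revenue with respect to the driver multiset B_j satisfies Rev_{B_j}(p_j) ≥ OPT(B_j)/c, where OPT(B_j) is the supremum revenue with respect to B_j over all pricings. Then there exists j such that the revenue of p_j with respect to the full multiset B satisfies Rev_B(p_j) ≥ OPT(B)/(c · k). -/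
open scoped ENNReal

open Toll

namespace Toll

variable {V : Type*} (G : SimpleGraph V)

/-- Revenue is additive over a finite sum of driver multisets. -/
theorem rev_sum {ι : Type*} (s : Finset ι) (Bs : ι → Multiset (V × V × NNReal))
    (p : Sym2 V → NNReal) : rev G (∑ i ∈ s, Bs i) p = ∑ i ∈ s, rev G (Bs i) p := by
  classical
  induction s using Finset.induction_on with
  | empty => simp [rev]
  | insert a s ha ih =>
    rw [Finset.sum_insert ha, Finset.sum_insert ha, ← ih]
    simp only [rev, Multiset.map_add, Multiset.sum_add]

/-- The optimal revenue is subadditive over a finite sum of driver multisets. -/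
theorem OPT_sum_le {ι : Type*} (s : Finset ι) (Bs : ι → Multiset (V × V × NNReal)) :
    OPT G (∑ i ∈ s, Bs i) ≤ ∑ i ∈ s, OPT G (Bs i) := by
  refine iSup_le fun p => ?_
  rw [rev_sum]
  exact Finset.sum_le_sum fun i _ => le_iSup (rev G (Bs i)) p

end Toll

/-- If `B` is partitioned into `B_1, …, B_k` and for each `j` the pricing `p_j` is a
`c`-approximation for the instance restricted to `B_j`, then some `p_j` is a
`c·k`-approximation for the full instance. -/
theorem best_partition_pricing {V : Type*} [Fintype V] [DecidableEq V]
    (G : SimpleGraph V) [DecidableRel G.Adj]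
    {k : ℕ} (hk : 1 ≤ k) (Bs : Fin k → Multiset (V × V × NNReal))
    (c : NNReal) (hc : 1 ≤ c)
    (ps : Fin k → Sym2 V → NNReal)
    (hps : ∀ j, OPT G (Bs j) / (c : ℝ≥0∞) ≤ rev G (Bs j) (ps j)) :
    ∃ j, OPT G (∑ i, Bs i) / ((c : ℝ≥0∞) * (k : ℝ≥0∞)) ≤
      rev G (∑ i, Bs i) (ps j) := by
  have : Nonempty (Fin k) := ⟨⟨0, hk⟩⟩
  obtain ⟨j, hj⟩ := Finite.exists_max fun i => OPT G (Bs i)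
  refine ⟨j, ?_⟩
  have hle : OPT G (∑ i, Bs i) ≤ OPT G (Bs j) * k := by
    calc OPT G (∑ i, Bs i) ≤ ∑ i, OPT G (Bs i) := OPT_sum_le G _ Bs
      _ ≤ ∑ _i : Fin k, OPT G (Bs j) := Finset.sum_le_sum fun i _ => hj i
      _ = OPT G (Bs j) * k := by simp [mul_comm]
  have hk0 : (k : ℝ≥0∞) ≠ 0 := by exact_mod_cast (by omega : k ≠ 0)
  calc OPT G (∑ i, Bs i) / ((c : ℝ≥0∞) * (k : ℝ≥0∞))
      ≤ OPT G (Bs j) * k / ((c : ℝ≥0∞) * (k : ℝ≥0∞)) := by gcongr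
    _ = OPT G (Bs j) / c := ENNReal.mul_div_mul_right _ _ hk0 (ENNReal.natCast_ne_top k)
    _ ≤ rev G (Bs j) (ps j) := hps j
    _ ≤ ∑ i, rev G (Bs i) (ps j) :=
        Finset.single_le_sum (f := fun i => rev G (Bs i) (ps j)) (fun _ _ => zero_le)
          (Finset.mem_univ j)
    _ = rev G (∑ i, Bs i) (ps j) := (rev_sum G _ Bs (ps j)).symm
end
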